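/- Two heaps H and H' over P are homeomorphic if and only if some subdivision of H in which every edge has weight 1 is isomorphic to some subdivision of H' in which every edge has weight 1 (i.e. iff their shells are isomorphic). -/

import Mathlib

/-- A heap over pointer variables `P`: a finite set `V` of vertices (drawn from `ℕ`),
a partial successor function `succ` (with `succ v = none` outside `V`),
an edge-weight function `wt` (weights are at least 1 on actual edges),
and a labelling `L` of pointer variables by vertices. -/
structure Heap (P : Type) where
  V : Finset ℕ
  succ : ℕ → Option ℕ
  wt : ℕ → ℕ
  L : P → ℕ
  label_mem : ∀ p, L p ∈ V
  succ_mem : ∀ v ∈ V, ∀ u, succ v = some u → u ∈ V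
  succ_dom : ∀ v, v ∉ V → succ v = none
  wt_pos : ∀ v ∈ V, succ v ≠ none → 1 ≤ wt v

namespace Heap

variable {P : Type}

/-- `vs` is a walk from `x` to `y`: a nonempty list of vertices starting at `x`,
ending at `y`, where each vertex's successor is the next list element. -/
def IsWalk (H : Heap P) (x y : ℕ) (vs : List ℕ) : Prop :=
  vs.head? = some x ∧ vs.getLast? = some y ∧
    List.Chain' (fun a b => H.succ a = some b) vs

/-- The weight of a walk: the sum of the weights of its edges,
i.e. of `wt vᵢ` over all but the last vertex. -/
def walkWeight (H : Heap P) (vs : List ℕ) : ℕ :=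
  (vs.dropLast.map H.wt).sum

/-- `pathLength H x y ∈ ℕ ∪ {∞}`: the least weight of a walk from `x` to `y`,
and `∞` if there is no walk. -/
noncomputable def pathLength (H : Heap P) (x y : ℕ) : ℕ∞ :=
  sInf {n : ℕ∞ | ∃ vs : List ℕ, H.IsWalk x y vs ∧ n = (H.walkWeight vs : ℕ∞)}

/-- `x` lies on a cycle: there is a walk from `x` to `x` with at least one step. -/
def Circular (H : Heap P) (x : ℕ) : Prop :=
  ∃ vs : List ℕ, H.IsWalk x x vs ∧ 2 ≤ vs.length

/-- A vertex is reachable if some labelled vertex reaches it by following successors. -/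
def Reachable (H : Heap P) (v : ℕ) : Prop :=
  ∃ p : P, Relation.ReflTransGen (fun a b => H.succ a = some b) (H.L p) v

/-- `H'` is obtained from `H` by a single-edge subdivision: the edge from `u`
(with `succ u = some v` and weight `n ≥ 2`) is split, for some `1 ≤ k < n`, by a
fresh vertex `q` into an edge `u → q` of weight `k` and an edge `q → v` of weight
`n - k`; everything else is unchanged. -/
def SingleSubdiv (H H' : Heap P) : Prop :=
  ∃ u v q k : ℕ,
    u ∈ H.V ∧ H.succ u = some v ∧ 2 ≤ H.wt u ∧ 1 ≤ k ∧ k < H.wt u ∧ q ∉ H.V ∧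
    H'.V = insert q H.V ∧
    H'.succ = Function.update (Function.update H.succ u (some q)) q (some v) ∧
    H'.wt = Function.update (Function.update H.wt u k) q (H.wt u - k) ∧
    H'.L = H.L

/-- `H'` is a subdivision of `H`: it is obtained from `H` by a finite (possibly
empty) sequence of single-edge subdivisions. -/
def Subdiv (H H' : Heap P) : Prop :=
  Relation.ReflTransGen SingleSubdiv H H'

/-- Heap isomorphism: a bijection between the reachable vertices that respects
labels, successors and weights. -/
def Iso (H H' : Heap P) : Prop :=
  ∃ f : ℕ → ℕ,
    Set.BijOn f {v | H.Reachable v} {v | H'.Reachable v} ∧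
    (∀ p, f (H.L p) = H'.L p) ∧
    (∀ v, H.Reachable v → H'.succ (f v) = Option.map f (H.succ v)) ∧
    (∀ v, H.Reachable v → H.succ v ≠ none → H'.wt (f v) = H.wt v)

/-- Heap homeomorphism: some subdivision of `H` is isomorphic to some
subdivision of `H'`. -/
def Homeo (H H' : Heap P) : Prop :=
  ∃ S S' : Heap P, H.Subdiv S ∧ H'.Subdiv S' ∧ Iso S S'

end Heap

/-- Every edge of `S` has weight 1. -/
def Heap.UnitWeights {P : Type} (S : Heap P) : Prop :=
  ∀ v ∈ S.V, S.succ v ≠ none → S.wt v = 1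

namespace Heap

variable {P : Type}

theorem mem_of_succ_eq_some (H : Heap P) {u v : ℕ} (hu : H.succ u = some v) : u ∈ H.V := by
  by_contra h
  simp [H.succ_dom u h] at hu

theorem Reachable.mem {H : Heap P} {x : ℕ} (h : H.Reachable x) : x ∈ H.V := by
  obtain ⟨p, hp⟩ := h
  induction hp with
  | refl => exact H.label_mem p
  | tail _ hab ih => exact H.succ_mem _ ih _ hab

theorem Reachable.label (H : Heap P) (p : P) : H.Reachable (H.L p) := ⟨p, .refl⟩

theorem Reachable.tail {H : Heap P} {x y : ℕ} (h : H.Reachable x) (hxy : H.succ x = some y) :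
    H.Reachable y :=
  h.imp fun _ hp => hp.tail hxy

/-- Split off the first unit of the edge from `u` to `v`, using the fresh vertex `q`. -/
def split (H : Heap P) (u v q : ℕ) (hu : H.succ u = some v) (hw : 2 ≤ H.wt u)
    (_hq : q ∉ H.V) : Heap P where
  V := insert q H.V
  succ := Function.update (Function.update H.succ u (some q)) q (some v)
  wt := Function.update (Function.update H.wt u 1) q (H.wt u - 1)
  L := H.L
  label_mem p := Finset.mem_insert_of_mem (H.label_mem p)
  succ_mem x hx y hy := by
    have hV := H.succ_mem u (H.mem_of_succ_eq_some hu) v hu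
    have hS := H.succ_mem x
    simp only [Function.update_apply] at hy
    grind
  succ_dom x hx := by
    have huV := H.mem_of_succ_eq_some hu
    have hS := H.succ_dom x
    simp only [Function.update_apply]
    grind
  wt_pos x hx hs := by
    have hS := H.wt_pos x
    simp only [Function.update_apply] at hs ⊢
    grind

section Split

variable (H : Heap P) {u v q : ℕ} (hu : H.succ u = some v) (hw : 2 ≤ H.wt u) (hq : q ∉ H.V)

theorem split_succ (x : ℕ) : (H.split u v q hu hw hq).succ x =
    if x = q then some v else if x = u then some q else H.succ x := by
  simp [split, Function.update_apply]

theorem split_wt (x : ℕ) : (H.split u v q hu hw hq).wt x =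
    if x = q then H.wt u - 1 else if x = u then 1 else H.wt x := by
  simp [split, Function.update_apply]

theorem singleSubdiv_split : H.SingleSubdiv (H.split u v q hu hw hq) :=
  ⟨u, v, q, 1, H.mem_of_succ_eq_some hu, hu, hw, le_rfl, hw, hq, rfl, rfl, rfl, rfl⟩

theorem reachable_split {x : ℕ} : (H.split u v q hu hw hq).Reachable x ↔
    H.Reachable x ∨ x = q ∧ H.Reachable u := by
  have hqu : u ≠ q := fun h => hq (h ▸ H.mem_of_succ_eq_some hu)
  have old : ∀ {y}, H.Reachable y → (H.split u v q hu hw hq).Reachable y := by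
    rintro y ⟨p, hp⟩
    induction hp with
    | refl => exact .label _ p
    | @tail a b _ hab ih =>
      have haq : a ≠ q := fun h => hq (h ▸ H.mem_of_succ_eq_some hab)
      by_cases hau : a = u
      · subst hau
        obtain rfl : v = b := by simpa [hu] using hab
        exact (ih.tail (y := q) (by simp [split_succ, hqu])).tail (by simp [split_succ])
      · exact ih.tail (by simp [split_succ, haq, hau, hab])
  constructor
  · rintro ⟨p, hp⟩
    induction hp with
    | refl => exact .inl (.label H p)
    | @tail a b _ hab ih =>
      rw [split_succ] at hab
      split_ifs at hab with haq hau
      · obtain rfl : v = b := by simpa using hab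
        rcases ih with ih | ih
        · exact absurd (haq ▸ ih.mem) hq
        · exact .inl (ih.2.tail hu)
      · obtain rfl : q = b := by simpa using hab
        rcases ih with ih | ih
        · exact .inr ⟨rfl, hau ▸ ih⟩
        · exact absurd ih.1 haq
      · rcases ih with ih | ih
        · exact .inl (ih.tail hab)
        · exact absurd ih.1 haq
  · rintro (h | ⟨rfl, h⟩)
    · exact old h
    · exact (old h).tail (by simp [split_succ, hqu])

/-- The total number of subdivision steps that the edge weights of `H` allow. -/
def excess (H : Heap P) : ℕ := ∑ x ∈ H.V, (H.wt x - 1)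

theorem excess_split_lt : (H.split u v q hu hw hq).excess < H.excess := by
  have huV := H.mem_of_succ_eq_some hu
  have hqu : u ≠ q := fun h => hq (h ▸ huV)
  have hV : (H.split u v q hu hw hq).V = insert q H.V := rfl
  unfold excess
  rw [hV, Finset.sum_insert hq, ← Finset.add_sum_erase _ _ huV, ← Finset.add_sum_erase _ _ huV]
  have hrest : ∑ x ∈ H.V.erase u, ((H.split u v q hu hw hq).wt x - 1) =
      ∑ x ∈ H.V.erase u, (H.wt x - 1) := by
    refine Finset.sum_congr rfl fun x hx => ?_
    rw [Finset.mem_erase] at hx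
    have hxq : x ≠ q := fun h => hq (h ▸ hx.2)
    simp [split_wt, hx.1, hxq]
  rw [hrest]
  simp only [split_wt, hqu, if_true, if_false]
  omega

theorem iso_split_left {H' : Heap P} (hr : ¬ H.Reachable u) (h : Iso H H') :
    Iso (H.split u v q hu hw hq) H' := by
  obtain ⟨f, hf, hL, hs, hwt⟩ := h
  have hreach : ∀ x, (H.split u v q hu hw hq).Reachable x ↔ H.Reachable x := fun x => by
    simp [reachable_split, hr]
  have hne : ∀ x, H.Reachable x → x ≠ q ∧ x ≠ u := fun x hx =>
    ⟨fun h => hq (h ▸ hx.mem), fun h => hr (h ▸ hx)⟩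
  refine ⟨f, by simpa only [hreach] using hf, hL, fun x hx => ?_, fun x hx => ?_⟩
  · rw [hreach] at hx
    simpa [split_succ, hne x hx] using hs x hx
  · rw [hreach] at hx
    simpa [split_succ, split_wt, hne x hx] using hwt x hx

theorem iso_split_right {H' : Heap P} (hr : ¬ H.Reachable u) (h : Iso H' H) :
    Iso H' (H.split u v q hu hw hq) := by
  obtain ⟨f, hf, hL, hs, hwt⟩ := h
  have hreach : ∀ x, (H.split u v q hu hw hq).Reachable x ↔ H.Reachable x := fun x => by
    simp [reachable_split, hr]
  have hne : ∀ x, H.Reachable x → x ≠ q ∧ x ≠ u := fun x hx =>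
    ⟨fun h => hq (h ▸ hx.mem), fun h => hr (h ▸ hx)⟩
  refine ⟨f, by simpa only [hreach] using hf, hL, fun x hx => ?_, fun x hx => ?_⟩
  · simpa [split_succ, hne _ (hf.mapsTo hx)] using hs x hx
  · simpa [split_wt, hne _ (hf.mapsTo hx)] using hwt x hx

theorem iso_split_split {H' : Heap P} {f : ℕ → ℕ} {q' : ℕ}
    (hf : Set.BijOn f {v | H.Reachable v} {v | H'.Reachable v})
    (hL : ∀ p, f (H.L p) = H'.L p)
    (hs : ∀ v, H.Reachable v → H'.succ (f v) = Option.map f (H.succ v))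
    (hwt : ∀ v, H.Reachable v → H.succ v ≠ none → H'.wt (f v) = H.wt v)
    (hr : H.Reachable u) (hu' : H'.succ (f u) = some (f v)) (hw' : 2 ≤ H'.wt (f u))
    (hq' : q' ∉ H'.V) :
    Iso (H.split u v q hu hw hq) (H'.split (f u) (f v) q' hu' hw' hq') := by
  have hne : ∀ x, H.Reachable x → x ≠ q := fun x hx h => hq (h ▸ hx.mem)
  have hne' : ∀ x, H.Reachable x → f x ≠ q' := fun x hx h =>
    hq' (h ▸ Reachable.mem (hf.mapsTo hx))
  have hru' : H'.Reachable (f u) := hf.mapsTo hr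
  have hfu : ∀ x, H.Reachable x → (f x = f u ↔ x = u) := fun x hx => hf.injOn.eq_iff hx hr
  have hg : ∀ x, H.Reachable x → Function.update f q q' x = f x := fun x hx =>
    Function.update_of_ne (hne x hx) _ _
  have hgq : Function.update f q q' q = q' := Function.update_self _ _ _
  refine ⟨Function.update f q q', ⟨?_, ?_, ?_⟩, fun p => ?_, fun x hx => ?_, fun x hx => ?_⟩
  · intro x hx
    rw [Set.mem_ofPred_eq, reachable_split] at hx ⊢
    rcases hx with hx | ⟨rfl, -⟩
    · rw [hg x hx]
      exact .inl (hf.mapsTo hx)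
    · exact .inr ⟨hgq, hru'⟩
  · intro x hx y hy hxy
    rw [Set.mem_ofPred_eq, reachable_split] at hx hy
    rcases hx with hx | ⟨rfl, -⟩ <;> rcases hy with hy | ⟨rfl, -⟩
    · rw [hg x hx, hg y hy] at hxy
      exact hf.injOn hx hy hxy
    · rw [hg x hx, hgq] at hxy
      exact absurd hxy (hne' x hx)
    · rw [hg y hy, hgq] at hxy
      exact absurd hxy.symm (hne' y hy)
    · rfl
  · intro y hy
    rw [Set.mem_ofPred_eq, reachable_split] at hy
    rcases hy with hy | ⟨rfl, -⟩
    · obtain ⟨x, hx, rfl⟩ := hf.surjOn hy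
      exact ⟨x, (H.reachable_split hu hw hq).2 (.inl hx), hg x hx⟩
    · exact ⟨q, (H.reachable_split hu hw hq).2 (.inr ⟨rfl, hr⟩), hgq⟩
  · exact (hg _ (.label H p)).trans (hL p)
  · rw [reachable_split] at hx
    rcases hx with hx | ⟨rfl, -⟩
    · rw [hg x hx, split_succ, split_succ, if_neg (hne x hx), if_neg (hne' x hx)]
      by_cases hxu : x = u
      · simp [hxu]
      · rw [if_neg hxu, if_neg (mt (hfu x hx).1 hxu), hs x hx]
        cases hy : H.succ x with
        | none => rfl
        | some y => simp [hg y (hx.tail hy)]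
    · simp [split_succ, hg v (hr.tail hu)]
  · rw [reachable_split] at hx
    rcases hx with hx | ⟨rfl, -⟩
    · rw [hg x hx, split_succ, split_wt, split_wt, if_neg (hne x hx), if_neg (hne' x hx),
        if_neg (hne x hx)]
      by_cases hxu : x = u
      · simp [hxu]
      · rw [if_neg hxu, if_neg (mt (hfu x hx).1 hxu), if_neg hxu]
        exact hwt x hx
    · simp [split_wt, hwt u hr (by simp [hu])]

end Split

theorem exists_heavy_edge {H : Heap P} (h : ¬ H.UnitWeights) :
    ∃ u v, H.succ u = some v ∧ 2 ≤ H.wt u := by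
  simp only [UnitWeights, not_forall] at h
  obtain ⟨u, huV, hs, hw⟩ := h
  obtain ⟨v, hv⟩ := Option.ne_none_iff_exists'.1 hs
  have := H.wt_pos u huV hs
  exact ⟨u, v, hv, by omega⟩

/-- Isomorphic heaps have isomorphic unit-weight subdivisions. -/
theorem Iso.exists_unitWeights_subdiv {S S' : Heap P} (h : Iso S S') :
    ∃ T T' : Heap P, S.Subdiv T ∧ S'.Subdiv T' ∧ T.UnitWeights ∧ T'.UnitWeights ∧ Iso T T' := by
  induction hn : S.excess + S'.excess using Nat.strong_induction_on generalizing S S' with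
  | _ n ih =>
  subst hn
  obtain ⟨q, hq⟩ := Infinite.exists_notMem_finset S.V
  obtain ⟨q', hq'⟩ := Infinite.exists_notMem_finset S'.V
  by_cases hS : S.UnitWeights
  · by_cases hS' : S'.UnitWeights
    · exact ⟨S, S', .refl, .refl, hS, hS', h⟩
    obtain ⟨u, v, hu, hw⟩ := exists_heavy_edge hS'
    have hr : ¬ S'.Reachable u := by
      intro hr
      obtain ⟨f, hf, -, hs, hwt⟩ := h
      obtain ⟨x, hx, rfl⟩ := hf.surjOn hr
      have hsx : S.succ x ≠ none := fun h0 => by simp [hs x hx, h0] at hu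
      have h1 := hS x hx.mem hsx
      have h2 := hwt x hx hsx
      omega
    obtain ⟨T, T', hT, hT', hrest⟩ := ih _
      (Nat.add_lt_add_left (S'.excess_split_lt hu hw hq') _)
      (S'.iso_split_right hu hw hq' hr h) rfl
    exact ⟨T, T', hT, .head (S'.singleSubdiv_split hu hw hq') hT', hrest⟩
  · obtain ⟨u, v, hu, hw⟩ := exists_heavy_edge hS
    by_cases hr : S.Reachable u
    · obtain ⟨f, hf, hL, hs, hwt⟩ := h
      have hu' : S'.succ (f u) = some (f v) := by simp [hs u hr, hu]
      have hw' : 2 ≤ S'.wt (f u) := by rwa [hwt u hr (by simp [hu])]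
      obtain ⟨T, T', hT, hT', hrest⟩ := ih _
        (Nat.add_lt_add (S.excess_split_lt hu hw hq) (S'.excess_split_lt hu' hw' hq'))
        (S.iso_split_split hu hw hq hf hL hs hwt hr hu' hw' hq') rfl
      exact ⟨T, T', .head (S.singleSubdiv_split hu hw hq) hT,
        .head (S'.singleSubdiv_split hu' hw' hq') hT', hrest⟩
    · obtain ⟨T, T', hT, hT', hrest⟩ := ih _
        (Nat.add_lt_add_right (S.excess_split_lt hu hw hq) _)
        (S.iso_split_left hu hw hq hr h) rfl
      exact ⟨T, T', .head (S.singleSubdiv_split hu hw hq) hT, hT', hrest⟩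

end Heap

/-- Characterisation of homeomorphism via shells: two heaps are homeomorphic iff
some all-unit-weight subdivision of the first is isomorphic to some
all-unit-weight subdivision of the second. -/
theorem homeo_iff_shells_iso {P : Type} (H H' : Heap P) :
    H.Homeo H' ↔
      ∃ S S' : Heap P, H.Subdiv S ∧ H'.Subdiv S' ∧
        S.UnitWeights ∧ S'.UnitWeights ∧ Heap.Iso S S' := by
  constructor
  · rintro ⟨S, S', hS, hS', h⟩
    obtain ⟨T, T', hT, hT', hrest⟩ := h.exists_unitWeights_subdiv
    exact ⟨T, T', hS.trans hT, hS'.trans hT', hrest⟩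
  · rintro ⟨S, S', hS, hS', -, -, h⟩
    exact ⟨S, S', hS, hS', h⟩
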